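/- Let a₀,a₁,a₂,a₃,a₄,ν be real numbers with ν ≠ 1, and let P, F, G, H be as defined. Define ζ(x,y) = −(x−y)(νx+y)(a₁−a₃xy)/(2(ν−1)H(x,y)) − (x+y)/(2(ν−1)(νx+y)) and Ω(x,y) = G(x,y)/F(x,y). Then at every point (x,y) with x ≠ y, νx+y ≠ 0, H(x,y) ≠ 0, F(x,y) ≠ 0, P(x) ≠ 0 and P(y) ≠ 0, the twist equations hold: ∂x ζ = −(F(x,y)²/(H(x,y)²·P(x)))·∂y Ω and ∂y ζ = −(F(x,y)²/(H(x,y)²·P(y)))·∂x Ω. (This says the twist one-form T = −λ²⋆_h dΩ of the Chen–Teo family is exact with potential ζ.) -/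

import Mathlib

theorem hasDerivAt_quartic (a₀ a₁ a₂ a₃ a₄ u : ℝ) :
    HasDerivAt (fun u : ℝ => a₀ + a₁*u + a₂*u^2 + a₃*u^3 + a₄*u^4)
      (a₁ + 2*a₂*u + 3*a₃*u^2 + 4*a₄*u^3) u := by
  have h := ((((hasDerivAt_const u a₀).add ((hasDerivAt_id' u).const_mul a₁)).add
    ((hasDerivAt_pow 2 u).const_mul a₂)).add ((hasDerivAt_pow 3 u).const_mul a₃)).add
    ((hasDerivAt_pow 4 u).const_mul a₄)
  refine h.congr_deriv ?_
  push_cast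
  ring


/-- The twist one-form `T = −λ²⋆_h dΩ` of the Chen–Teo family is exact with
potential `ζ`: the twist equations in coordinates. -/
theorem chenTeo_twist_potential
    (a₀ a₁ a₂ a₃ a₄ ν : ℝ) (hν : ν ≠ 1)
    (P : ℝ → ℝ) (hP : ∀ u, P u = a₀ + a₁*u + a₂*u^2 + a₃*u^3 + a₄*u^4)
    (F G H : ℝ → ℝ → ℝ)
    (hF : ∀ x y, F x y = y^2 * P x - x^2 * P y)
    (hH : ∀ x y, H x y =
      (ν*x + y) * ((ν*x - y)*(a₁ - a₃*x*y) - 2*(1 - ν)*(a₀ - a₄*x^2*y^2)))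
    (hG : ∀ x y, G x y =
      (ν^2*a₀ + 2*ν*a₃*y^3 + 2*ν*a₄*y^4 - a₄*y^4) * P x
        + (a₀ - 2*ν*a₀ - 2*ν*a₁*x - ν^2*a₄*x^4) * P y)
    (ζ Ω : ℝ → ℝ → ℝ)
    (hζ : ∀ x y, ζ x y = -((x - y)*(ν*x + y)*(a₁ - a₃*x*y)) / (2*(ν - 1)*(H x y))
        - (x + y) / (2*(ν - 1)*(ν*x + y)))
    (hΩ : ∀ x y, Ω x y = G x y / F x y)
    (x y : ℝ) (hxy : x ≠ y) (hne : ν*x + y ≠ 0)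
    (hHne : H x y ≠ 0) (hFne : F x y ≠ 0) (hPx : P x ≠ 0) (hPy : P y ≠ 0) :
    deriv (fun t => ζ t y) x
        = -((F x y)^2 / ((H x y)^2 * P x)) * deriv (fun s => Ω x s) y
      ∧ deriv (fun s => ζ x s) y
        = -((F x y)^2 / ((H x y)^2 * P y)) * deriv (fun t => Ω t y) x := by
  have hν' : 2*(ν - 1) ≠ 0 := mul_ne_zero two_ne_zero (sub_ne_zero.mpr hν)
  have hP' : ∀ u, HasDerivAt P (a₁ + 2*a₂*u + 3*a₃*u^2 + 4*a₄*u^3) u := fun u => by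
    rw [funext hP]
    exact hasDerivAt_quartic a₀ a₁ a₂ a₃ a₄ u
  set K := (ν*x - y)*(a₁ - a₃*x*y) - 2*(1 - ν)*(a₀ - a₄*x^2*y^2) with hK
  have hHK : H x y = (ν*x + y)*K := hH x y
  have hKne : K ≠ 0 := right_ne_zero_of_mul (hHK ▸ hHne)
  have hNx : HasDerivAt (fun t => -((t - y)*(ν*t + y)*(a₁ - a₃*t*y)))
      (-((ν*x + y + (x - y)*ν)*(a₁ - a₃*x*y) - (x - y)*(ν*x + y)*(a₃*y))) x := by
    have h := ((((hasDerivAt_id' x).sub_const y).fun_mul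
      (((hasDerivAt_id' x).const_mul ν).add_const y)).fun_mul
      ((((hasDerivAt_id' x).const_mul a₃).mul_const y).const_sub a₁)).neg
    exact h.congr_deriv (by ring)
  have hNy : HasDerivAt (fun s => -((x - s)*(ν*x + s)*(a₁ - a₃*x*s)))
      (-((-(ν*x + y) + (x - y))*(a₁ - a₃*x*y) - (x - y)*(ν*x + y)*(a₃*x))) y := by
    have h := ((((hasDerivAt_id' y).const_sub x).fun_mul
      ((hasDerivAt_id' y).const_add (ν*x))).fun_mul
      (((hasDerivAt_id' y).const_mul (a₃*x)).const_sub a₁)).neg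
    exact h.congr_deriv (by ring)
  have hHx : HasDerivAt (fun t => H t y)
      (ν*K + (ν*x + y)*(ν*(a₁ - a₃*x*y) - (ν*x - y)*(a₃*y) + 4*(1 - ν)*a₄*x*y^2)) x := by
    simp only [hH]
    have h := (((hasDerivAt_id' x).const_mul ν).add_const y).fun_mul
      (((((hasDerivAt_id' x).const_mul ν).sub_const y).fun_mul
        ((((hasDerivAt_id' x).const_mul a₃).mul_const y).const_sub a₁)).fun_sub
        (((((hasDerivAt_pow 2 x).const_mul a₄).mul_const (y^2)).const_sub a₀).const_mul
          (2*(1 - ν))))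
    exact h.congr_deriv (by push_cast; ring)
  have hHy : HasDerivAt (fun s => H x s)
      (K + (ν*x + y)*(-(a₁ - a₃*x*y) - (ν*x - y)*(a₃*x) + 4*(1 - ν)*a₄*x^2*y)) y := by
    simp only [hH]
    have h := ((hasDerivAt_id' y).const_add (ν*x)).fun_mul
      ((((hasDerivAt_id' y).const_sub (ν*x)).fun_mul
        (((hasDerivAt_id' y).const_mul (a₃*x)).const_sub a₁)).fun_sub
        ((((hasDerivAt_pow 2 y).const_mul (a₄*x^2)).const_sub a₀).const_mul (2*(1 - ν))))
    exact h.congr_deriv (by push_cast; ring)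
  have hFx : HasDerivAt (fun t => F t y)
      (y^2*(a₁ + 2*a₂*x + 3*a₃*x^2 + 4*a₄*x^3) - 2*x*P y) x := by
    simp only [hF]
    have h := ((hP' x).const_mul (y^2)).sub ((hasDerivAt_pow 2 x).mul_const (P y))
    exact h.congr_deriv (by push_cast; ring)
  have hFy : HasDerivAt (fun s => F x s)
      (2*y*P x - x^2*(a₁ + 2*a₂*y + 3*a₃*y^2 + 4*a₄*y^3)) y := by
    simp only [hF]
    have h := ((hasDerivAt_pow 2 y).mul_const (P x)).sub ((hP' y).const_mul (x^2))
    exact h.congr_deriv (by push_cast; ring)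
  have hGx : HasDerivAt (fun t => G t y)
      ((ν^2*a₀ + 2*ν*a₃*y^3 + 2*ν*a₄*y^4 - a₄*y^4)*(a₁ + 2*a₂*x + 3*a₃*x^2 + 4*a₄*x^3)
        + (-2*ν*a₁ - 4*ν^2*a₄*x^3)*P y) x := by
    simp only [hG]
    have h := ((hP' x).const_mul (ν^2*a₀ + 2*ν*a₃*y^3 + 2*ν*a₄*y^4 - a₄*y^4)).add
      (((((hasDerivAt_id' x).const_mul (2*ν*a₁)).const_sub (a₀ - 2*ν*a₀)).fun_sub
        ((hasDerivAt_pow 4 x).const_mul (ν^2*a₄))).mul_const (P y))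
    exact h.congr_deriv (by push_cast; ring)
  have hGy : HasDerivAt (fun s => G x s)
      ((6*ν*a₃*y^2 + 8*ν*a₄*y^3 - 4*a₄*y^3)*P x
        + (a₀ - 2*ν*a₀ - 2*ν*a₁*x - ν^2*a₄*x^4)*(a₁ + 2*a₂*y + 3*a₃*y^2 + 4*a₄*y^3)) y := by
    simp only [hG]
    have h := (((((hasDerivAt_pow 3 y).const_mul (2*ν*a₃)).const_add (ν^2*a₀)).add
      ((hasDerivAt_pow 4 y).const_mul (2*ν*a₄))).fun_sub
        ((hasDerivAt_pow 4 y).const_mul a₄)).mul_const (P x) |>.add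
      ((hP' y).const_mul (a₀ - 2*ν*a₀ - 2*ν*a₁*x - ν^2*a₄*x^4))
    exact h.congr_deriv (by push_cast; ring)
  have hζx := (hNx.fun_div (hHx.const_mul (2*(ν - 1))) (mul_ne_zero hν' hHne)).fun_sub
    (((hasDerivAt_id' x).add_const y).fun_div
      ((((hasDerivAt_id' x).const_mul ν).add_const y).const_mul (2*(ν - 1)))
      (mul_ne_zero hν' hne))
  have hζy := (hNy.fun_div (hHy.const_mul (2*(ν - 1))) (mul_ne_zero hν' hHne)).fun_sub
    (((hasDerivAt_id' y).const_add x).fun_div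
      (((hasDerivAt_id' y).const_add (ν*x)).const_mul (2*(ν - 1)))
      (mul_ne_zero hν' hne))
  have hΩx := hGx.fun_div hFx hFne
  have hΩy := hGy.fun_div hFy hFne
  simp only [← hζ, ← hΩ] at hζx hζy hΩx hΩy
  rw [hζx.deriv, hζy.deriv, hΩx.deriv, hΩy.deriv, hHK]
  have hν1 : ν - 1 ≠ 0 := sub_ne_zero.mpr hν
  constructor
  · field_simp
    rw [hG, hF, hK, hP x, hP y]
    ring
  · field_simp
    rw [hG, hF, hK, hP x, hP y]
    ring
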